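/- Assume the measure μ is non-atomic and σ-finite, let φ be a deformed exponential, and let u₀ : T → (0,∞) be measurable. Suppose there do NOT exist α ∈ (0,1) and a measurable function c : T → ℝ ∪ {−∞} with ∫_T φ(c) dμ < ∞ such that for μ-a.e. t ∈ T one has α·φ(u) ≤ φ(u − u₀(t)) for all u ≥ c(t). Then there exist a sequence {c_n} of measurable real-valued functions on T and a sequence {A_n} of pairwise disjoint measurable sets such that ∫_{A_n} φ(c_n) dμ = 1 and ∫_{A_n} φ(c_n − u₀) dμ ≤ 2^{−n} for all n ≥ 1. -/

import Mathlib

open MeasureTheory Filter Set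

/-- The deformed exponential `φ` extended to `ℝ ∪ {−∞}` (as a subset of `EReal`),
with the convention `φ(−∞) = 0`, valued in `ℝ≥0∞` for integration. -/
noncomputable def phiE (φ : ℝ → ℝ) : EReal → ENNReal :=
  fun x => if x = ⊥ then 0 else ENNReal.ofReal (φ x.toReal)

/-- Small subsets exist for atomless measures. -/
lemma aux_small {T : Type*} [MeasurableSpace T] (ν : Measure T)
    (hna : ∀ A : Set T, MeasurableSet A → 0 < ν A →
      ∃ B ⊆ A, MeasurableSet B ∧ 0 < ν B ∧ 0 < ν (A \ B))
    (A : Set T) (hA : MeasurableSet A) (hpos : 0 < ν A) (hfin : ν A ≠ ⊤)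
    (ε : ENNReal) (hε : 0 < ε) :
    ∃ B ⊆ A, MeasurableSet B ∧ 0 < ν B ∧ ν B < ε := by
  have key : ∀ k : ℕ, ∃ B ⊆ A, MeasurableSet B ∧ 0 < ν B ∧ 2 ^ k * ν B ≤ ν A := by
    intro k
    induction k with
    | zero => exact ⟨A, subset_rfl, hA, hpos, by simp⟩
    | succ k ih =>
      obtain ⟨B, hBA, hB, hB0, hBk⟩ := ih
      obtain ⟨C, hCB, hC, hC0, hC1⟩ := hna B hB hB0
      have hsum : ν C + ν (B \ C) = ν B := by
        rw [← measure_union disjoint_sdiff_right (hB.diff hC), union_sdiff_cancel hCB]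
      rcases le_total (ν C) (ν (B \ C)) with h | h
      · refine ⟨C, hCB.trans hBA, hC, hC0, le_trans ?_ hBk⟩
        rw [pow_succ, mul_assoc]
        gcongr
        rw [two_mul, ← hsum]
        gcongr
      · refine ⟨B \ C, sdiff_subset.trans hBA, hB.diff hC, hC1, le_trans ?_ hBk⟩
        rw [pow_succ, mul_assoc]
        gcongr
        rw [two_mul, ← hsum]
        gcongr
  obtain ⟨k, hk⟩ := ENNReal.exists_nat_mul_gt hε.ne' hfin
  obtain ⟨B, hBA, hB, hB0, hBk⟩ := key k
  refine ⟨B, hBA, hB, hB0, ?_⟩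
  by_contra! hcon
  have h1 : (k : ENNReal) * ε ≤ 2 ^ k * ν B := by
    gcongr
    exact_mod_cast (Nat.lt_two_pow_self).le
  exact absurd (hk.trans_le (h1.trans hBk)) (lt_irrefl _)

/-- Sierpinski's theorem. -/
lemma aux_sierp {T : Type*} [MeasurableSpace T] (ν : Measure T)
    (hna : ∀ A : Set T, MeasurableSet A → 0 < ν A →
      ∃ B ⊆ A, MeasurableSet B ∧ 0 < ν B ∧ 0 < ν (A \ B))
    (A : Set T) (hA : MeasurableSet A) (hfin : ν A ≠ ⊤)
    (r : ENNReal) (hr : r ≤ ν A) :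
    ∃ B ⊆ A, MeasurableSet B ∧ ν B = r := by
  have hrfin : r ≠ ⊤ := ne_top_of_le_ne_top hfin hr
  have step : ∀ B : {B : Set T // B ⊆ A ∧ MeasurableSet B ∧ ν B ≤ r},
      ∃ C ⊆ A \ B.1, MeasurableSet C ∧ ν B.1 + ν C ≤ r ∧
        ∀ D ⊆ A \ B.1, MeasurableSet D → ν B.1 + ν D ≤ r → ν D ≤ 2 * ν C := by
    rintro ⟨B, hBA, hB, hBr⟩
    let S : Set ENNReal := {x | ∃ D ⊆ A \ B, MeasurableSet D ∧ ν B + ν D ≤ r ∧ ν D = x}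
    by_cases hs : sSup S = 0
    · refine ⟨∅, empty_subset _, MeasurableSet.empty, by simpa using hBr, ?_⟩
      intro D hD hDm hDr
      have : ν D ≤ sSup S := le_sSup ⟨D, hD, hDm, hDr, rfl⟩
      rw [hs] at this
      exact this.trans zero_le
    · have hSr : sSup S ≤ r := by
        apply sSup_le
        rintro x ⟨D, _, _, h, rfl⟩
        exact le_trans le_add_self h
      have hlt : sSup S / 2 < sSup S :=
        ENNReal.half_lt_self hs (ne_top_of_le_ne_top hrfin hSr)
      obtain ⟨x, ⟨C, hC, hCm, hCr, rfl⟩, hx⟩ := lt_sSup_iff.1 hlt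
      refine ⟨C, hC, hCm, hCr, ?_⟩
      intro D hD hDm hDr
      have h1 : ν D ≤ sSup S := le_sSup ⟨D, hD, hDm, hDr, rfl⟩
      calc ν D ≤ sSup S := h1
        _ = 2 * (sSup S / 2) := (ENNReal.mul_div_cancel (by simp) (by simp)).symm
        _ ≤ 2 * ν C := by gcongr
  choose C hCA hCm hCr hCmax using step
  let nxt : {B : Set T // B ⊆ A ∧ MeasurableSet B ∧ ν B ≤ r} →
      {B : Set T // B ⊆ A ∧ MeasurableSet B ∧ ν B ≤ r} := fun B =>
    ⟨B.1 ∪ C B, union_subset B.2.1 ((hCA B).trans sdiff_subset), B.2.2.1.union (hCm B),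
      (measure_union_le _ _).trans (hCr B)⟩
  let Q : ℕ → {B : Set T // B ⊆ A ∧ MeasurableSet B ∧ ν B ≤ r} := fun k =>
    Nat.rec ⟨∅, empty_subset _, MeasurableSet.empty, by simp⟩ (fun _ B => nxt B) k
  have hQs : ∀ k, (Q (k+1)).1 = (Q k).1 ∪ C (Q k) := fun k => rfl
  have hmono : Monotone fun k => (Q k).1 := by
    apply monotone_nat_of_le_succ
    intro k
    rw [hQs]
    exact subset_union_left
  let U := ⋃ k, (Q k).1
  have hUA : U ⊆ A := iUnion_subset fun k => (Q k).2.1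
  have hUm : MeasurableSet U := MeasurableSet.iUnion fun k => (Q k).2.2.1
  have hUr : ν U ≤ r := by
    rw [hmono.measure_iUnion]
    exact iSup_le fun k => (Q k).2.2.2
  refine ⟨U, hUA, hUm, ?_⟩
  by_contra hne
  have hlt : ν U < r := lt_of_le_of_ne hUr hne
  have hUfin : ν U ≠ ⊤ := hlt.ne_top
  have hpos : 0 < ν (A \ U) := by
    rw [measure_sdiff hUA hUm.nullMeasurableSet hUfin]
    exact tsub_pos_of_lt (hlt.trans_le hr)
  obtain ⟨D, hDA, hDm, hD0, hDr⟩ := aux_small ν hna (A \ U) (hA.diff hUm) hpos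
    (ne_top_of_le_ne_top hfin (measure_mono sdiff_subset)) (r - ν U) (tsub_pos_of_lt hlt)
  have hD : ∀ k, ν D ≤ 2 * ν (C (Q k)) := by
    intro k
    apply hCmax (Q k) D _ hDm
    · calc ν (Q k).1 + ν D ≤ ν U + (r - ν U) := by
            gcongr
            exact subset_iUnion (fun k => (Q k).1) k
        _ = r := add_tsub_cancel_of_le hUr
    · exact hDA.trans (sdiff_subset_sdiff_right (subset_iUnion (fun k => (Q k).1) k))
  have hk : ∀ k : ℕ, k * ν D ≤ 2 * ν (Q k).1 := by
    intro k
    induction k with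
    | zero => simp
    | succ k ih =>
      rw [hQs, measure_union _ (hCm _), mul_add]
      · push_cast
        rw [add_mul, one_mul]
        exact add_le_add ih (hD k)
      · exact disjoint_sdiff_right.mono_right (hCA _)
  obtain ⟨k, hk'⟩ := ENNReal.exists_nat_mul_gt hD0.ne' (ENNReal.mul_ne_top ENNReal.ofNat_ne_top hrfin : 2 * r ≠ ⊤)
  have : 2 * ν (Q k).1 ≤ 2 * r := by
    gcongr
    exact (Q k).2.2.2
  exact absurd (hk'.trans_le ((hk k).trans this)) (lt_irrefl _)

/-- The negated hypothesis localized to a set. -/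
def AuxSmallOn {T : Type*} [MeasurableSpace T] (μ : Measure T) (φ : ℝ → ℝ) (u₀ : T → ℝ)
    (E : Set T) : Prop :=
  ∃ α : ℝ, α ∈ Set.Ioo (0 : ℝ) 1 ∧
      ∃ c : T → EReal, Measurable c ∧ (∀ t, c t ≠ ⊤) ∧
        (∫⁻ t in E, phiE φ (c t) ∂μ < ⊤) ∧
        (∀ᵐ t ∂μ, t ∈ E → ∀ u : ℝ, c t ≤ (u : EReal) → α * φ u ≤ φ (u - u₀ t))

lemma aux_union {T : Type*} [MeasurableSpace T] (μ : Measure T) (φ : ℝ → ℝ)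
    (hnonneg : ∀ u, 0 ≤ φ u) (u₀ : T → ℝ)
    (E F G : Set T) (hE : MeasurableSet E) (hF : MeasurableSet F)
    (h : G ⊆ E ∪ F)
    (h1 : AuxSmallOn μ φ u₀ E) (h2 : AuxSmallOn μ φ u₀ F) :
    AuxSmallOn μ φ u₀ G := by
  classical
  obtain ⟨a, ha, c, hc, hct, hci, hca⟩ := h1
  obtain ⟨b, hb, d, hd, hdt, hdi, hda⟩ := h2
  refine ⟨min a b, ⟨lt_min ha.1 hb.1, (min_le_left _ _).trans_lt ha.2⟩,
    E.piecewise c d, hc.piecewise hE hd, ?_, ?_, ?_⟩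
  · intro t
    by_cases ht : t ∈ E <;> simp [ht, hct, hdt]
  · calc ∫⁻ t in G, phiE φ (E.piecewise c d t) ∂μ
        ≤ ∫⁻ t in E ∪ (F \ E), phiE φ (E.piecewise c d t) ∂μ := by
          apply lintegral_mono_set
          rwa [union_sdiff_self]
      _ ≤ ∫⁻ t in E, phiE φ (E.piecewise c d t) ∂μ
          + ∫⁻ t in F \ E, phiE φ (E.piecewise c d t) ∂μ := lintegral_union_le _ _ _
      _ = ∫⁻ t in E, phiE φ (c t) ∂μ + ∫⁻ t in F \ E, phiE φ (d t) ∂μ := by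
          congr 1
          · apply setLIntegral_congr_fun hE
            intro t ht
            simp [ht]
          · apply setLIntegral_congr_fun (hF.diff hE)
            intro t ht
            simp [ht.2]
      _ ≤ ∫⁻ t in E, phiE φ (c t) ∂μ + ∫⁻ t in F, phiE φ (d t) ∂μ := by
          gcongr
          exact sdiff_subset
      _ < ⊤ := ENNReal.add_lt_top.2 ⟨hci, hdi⟩
  · filter_upwards [hca, hda] with t h1 h2 hG u hu
    by_cases ht : t ∈ E
    · simp only [ht, piecewise_eq_of_mem] at hu
      exact (mul_le_mul_of_nonneg_right (min_le_left _ _) (hnonneg u)).trans (h1 ht u hu)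
    · simp only [ht, not_false_eq_true, piecewise_eq_of_notMem] at hu
      have htF : t ∈ F := (h hG).resolve_left ht
      exact (mul_le_mul_of_nonneg_right (min_le_right _ _) (hnonneg u)).trans (h2 htF u hu)

lemma aux_select {T : Type*} [MeasurableSpace T] (φ : ℝ → ℝ) (hφ : Measurable φ)
    (u₀ : T → ℝ) (hu₀ : Measurable u₀) (α : ℝ) (s : Finset ℚ) :
    ∃ c : T → ℝ, Measurable c ∧ ∀ t, ∀ q ∈ s, φ (q - u₀ t) < α * φ q →
      (φ (c t - u₀ t) < α * φ (c t) ∧ φ q ≤ φ (c t)) := by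
  classical
  induction s using Finset.induction_on with
  | empty => exact ⟨fun _ => 0, measurable_const, by simp⟩
  | insert q s hq ih =>
    obtain ⟨c, hc, h⟩ := ih
    let P : Set T := {t | φ (q - u₀ t) < α * φ q ∧
      ¬ (φ (c t - u₀ t) < α * φ (c t) ∧ φ q ≤ φ (c t))}
    have m1 : MeasurableSet {t | φ (q - u₀ t) < α * φ q} :=
      measurableSet_lt (by fun_prop) (by fun_prop)
    have m2 : MeasurableSet {t | φ (c t - u₀ t) < α * φ (c t)} :=
      measurableSet_lt (by fun_prop) (by fun_prop)
    have m3 : MeasurableSet {t | φ q ≤ φ (c t)} :=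
      measurableSet_le (by fun_prop) (by fun_prop)
    have hP : MeasurableSet P := m1.inter (m2.inter m3).compl
    refine ⟨P.piecewise (fun _ => (q : ℝ)) c, measurable_const.piecewise hP hc, ?_⟩
    intro t p hp hpt
    by_cases ht : t ∈ P
    · simp only [ht, piecewise_eq_of_mem]
      refine ⟨ht.1, ?_⟩
      rcases Finset.mem_insert.1 hp with rfl | hp
      · exact le_rfl
      · obtain ⟨h1, h2⟩ := h t p hp hpt
        by_contra! hcon
        exact ht.2 ⟨h1, hcon.le.trans h2⟩
    · simp only [ht, not_false_eq_true, piecewise_eq_of_notMem]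
      rcases Finset.mem_insert.1 hp with rfl | hp
      · by_contra hcon
        exact ht ⟨hpt, hcon⟩
      · exact h t p hp hpt

lemma aux_big {T : Type*} [MeasurableSpace T] (μ : Measure T)
    (φ : ℝ → ℝ) (hφ : Continuous φ) (htop : Tendsto φ atTop atTop)
    (u₀ : T → ℝ) (hu₀ : Measurable u₀) (E : Set T) (hE : MeasurableSet E)
    (hbig : ¬ AuxSmallOn μ φ u₀ E) (α : ℝ) (hα : α ∈ Set.Ioo (0 : ℝ) 1) :
    ∃ (c : T → ℝ) (A : Set T), Measurable c ∧ MeasurableSet A ∧ A ⊆ E ∧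
      (∀ t ∈ A, φ (c t - u₀ t) < α * φ (c t)) ∧
      2 < ∫⁻ t in A, ENNReal.ofReal (φ (c t)) ∂μ := by
  classical
  have hφm := hφ.measurable
  let G : ℚ → Set T := fun q => {t | φ (q - u₀ t) < α * φ q}
  have hG : ∀ q, MeasurableSet (G q) := fun q =>
    measurableSet_lt (by fun_prop) (by fun_prop)
  let g : ℚ → T → ENNReal := fun q => (G q).indicator fun _ => ENNReal.ofReal (φ q)
  have hg : ∀ q, Measurable (g q) := fun q => measurable_const.indicator (hG q)
  have hinf : ∫⁻ t in E, ⨆ q, g q t ∂μ = ⊤ := by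
    by_contra hfin
    apply hbig
    let c : T → EReal := fun t => ⨆ q : ℚ, if t ∈ G q then ((q : ℝ) : EReal) else ⊥
    have hc : Measurable c := Measurable.iSup fun q =>
      Measurable.ite (hG q) measurable_const measurable_const
    have hle : ∀ t q, t ∈ G q → ((q : ℝ) : EReal) ≤ c t := by
      intro t q ht
      refine le_trans ?_ (le_iSup (fun q : ℚ => if t ∈ G q then ((q : ℝ) : EReal) else ⊥) q)
      simp [ht]
    have hgle : ∀ t q, t ∈ G q → ENNReal.ofReal (φ q) ≤ ⨆ q, g q t := by
      intro t q ht
      refine le_trans ?_ (le_iSup (fun q => g q t) q)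
      simp [g, ht]
    have hlt : ∀ t (x : EReal), x < c t → ∃ q : ℚ, t ∈ G q ∧ x < ((q : ℝ) : EReal) := by
      intro t x hx
      obtain ⟨q, hq⟩ := lt_iSup_iff.1 hx
      by_cases ht : t ∈ G q
      · exact ⟨q, ht, by simpa [ht] using hq⟩
      · simp [ht] at hq
    have htopF : ∀ t, c t = ⊤ → ⨆ q, g q t = ⊤ := by
      intro t ht
      apply ENNReal.eq_top_of_forall_nnreal_le
      intro r
      obtain ⟨M, hM⟩ := eventually_atTop.1 (htop.eventually_ge_atTop (r : ℝ))
      obtain ⟨q, hq, hMq⟩ := hlt t (M : EReal) (by rw [ht]; exact EReal.coe_lt_top M)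
      refine le_trans ?_ (hgle t q hq)
      have := hM q (EReal.coe_lt_coe_iff.1 hMq).le
      rw [← ENNReal.ofReal_coe_nnreal]
      exact ENNReal.ofReal_le_ofReal this
    have hae : ∀ᵐ t ∂μ, t ∈ E → ⨆ q, g q t < ⊤ := by
      rw [← ae_restrict_iff' hE]
      exact ae_lt_top (Measurable.iSup hg) hfin
    have hcm : MeasurableSet {t | c t = ⊤} := hc (measurableSet_singleton _)
    refine ⟨α, hα, {t | c t = ⊤}.piecewise (fun _ => ⊥) c,
      measurable_const.piecewise hcm hc, ?_, ?_, ?_⟩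
    · intro t
      by_cases ht : c t = ⊤
      · simp [piecewise, ht]
      · simp [piecewise, ht]
    · refine lt_of_le_of_lt (lintegral_mono fun t => ?_) (lt_top_iff_ne_top.2 hfin)
      by_cases ht : c t = ⊤
      · simp [piecewise, ht, phiE]
      · simp only [piecewise, mem_ofPred_eq, ht, if_false, phiE]
        split_ifs with hb
        · exact zero_le
        · lift c t to ℝ using ⟨ht, hb⟩ with x hx
          rw [EReal.toReal_coe]
          have hcl : IsClosed {y : ℝ | ENNReal.ofReal (φ y) ≤ ⨆ q, g q t} :=
            isClosed_le (ENNReal.continuous_ofReal.comp hφ) continuous_const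
          have hmem : x ∈ closure {y : ℝ | ENNReal.ofReal (φ y) ≤ ⨆ q, g q t} := by
            rw [Metric.mem_closure_iff]
            intro ε hε
            obtain ⟨q, hq, hxq⟩ := hlt t ((x - ε : ℝ) : EReal) (by
              rw [← hx]; exact EReal.coe_lt_coe_iff.2 (by linarith))
            refine ⟨q, hgle t q hq, ?_⟩
            have h1 := EReal.coe_lt_coe_iff.1 hxq
            have h2 := hle t q hq
            rw [← hx] at h2
            have h3 := EReal.coe_le_coe_iff.1 h2
            rw [Real.dist_eq, abs_of_nonneg (by linarith)]
            linarith
          rw [hcl.closure_eq] at hmem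
          exact hmem
    · filter_upwards [hae] with t hF htE u hu
      have ht : c t ≠ ⊤ := fun h => (hF htE).ne (htopF t h)
      simp only [piecewise, mem_ofPred_eq, ht, if_false] at hu
      by_contra! hcon
      have hopen : IsOpen {y : ℝ | φ (y - u₀ t) < α * φ y} :=
        isOpen_lt (by fun_prop) (by fun_prop)
      obtain ⟨ε, hε, hball⟩ := Metric.isOpen_iff.1 hopen u hcon
      obtain ⟨q, hq1, hq2⟩ := exists_rat_btwn (show u < u + ε by linarith)
      have hq : t ∈ G q := hball (by
        rw [Metric.mem_ball, Real.dist_eq, abs_of_pos (by linarith)]; linarith)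
      have := EReal.coe_le_coe_iff.1 ((hle t q hq).trans hu)
      linarith
  rw [lintegral_congr (g := fun t => ⨆ s : Finset ℚ, ⨆ q ∈ s, g q t)
    (fun t => iSup_eq_iSup_finset _), lintegral_iSup_directed] at hinf
  · have : (2 : ENNReal) < ⨆ s : Finset ℚ, ∫⁻ t in E, ⨆ q ∈ s, g q t ∂μ := by
      rw [hinf]; simp
    obtain ⟨s, hs⟩ := lt_iSup_iff.1 this
    obtain ⟨c, hc, h⟩ := aux_select φ hφm u₀ hu₀ α s
    have m2 : MeasurableSet {t | φ (c t - u₀ t) < α * φ (c t)} :=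
      measurableSet_lt (by fun_prop) (by fun_prop)
    refine ⟨c, E ∩ {t | φ (c t - u₀ t) < α * φ (c t)}, hc, hE.inter m2, inter_subset_left,
      fun t ht => ht.2, hs.trans_le ?_⟩
    rw [inter_comm, ← setLIntegral_indicator m2]
    apply lintegral_mono
    intro t
    refine iSup₂_le fun q hq => ?_
    by_cases hqt : t ∈ G q
    · obtain ⟨h1, h2⟩ := h t q hq hqt
      rw [indicator_of_mem (show t ∈ {t | φ (c t - u₀ t) < α * φ (c t)} from h1)]
      simp only [g, indicator_of_mem hqt]
      exact ENNReal.ofReal_le_ofReal h2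
    · simp [g, hqt]
  · intro s
    exact (Measurable.biSup _ s.countable_toSet fun q _ => hg q).aemeasurable
  · intro s s'
    refine ⟨s ∪ s', fun t => ?_, fun t => ?_⟩
    · exact biSup_mono fun q hq => Finset.mem_union_left _ hq
    · exact biSup_mono fun q hq => Finset.mem_union_right _ hq
/-- For a non-atomic σ-finite measure `μ`, a deformed exponential `φ` and a
measurable positive `u₀`: if there exist no `α ∈ (0,1)` and measurable `c : T → ℝ ∪ {−∞}`
with `∫ φ(c) dμ < ∞` such that a.e. `α φ(u) ≤ φ(u − u₀(t))` for all `u ≥ c(t)`, then there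
are real-valued measurable functions `{c_n}` and pairwise disjoint measurable sets `{A_n}`
with `∫_{A_n} φ(c_n) dμ = 1` and `∫_{A_n} φ(c_n − u₀) dμ ≤ 2^{−n}` for all `n ≥ 1`. -/
theorem technical_lemma_nonatomic
    {T : Type*} [MeasurableSpace T] (μ : Measure T) [SigmaFinite μ]
    (hna : ∀ A : Set T, MeasurableSet A → 0 < μ A →
      ∃ B ⊆ A, MeasurableSet B ∧ 0 < μ B ∧ μ B < μ A)
    (φ : ℝ → ℝ) (hconv : ConvexOn ℝ Set.univ φ) (hnonneg : ∀ u, 0 ≤ φ u)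
    (hbot : Tendsto φ atBot (nhds 0)) (htop : Tendsto φ atTop atTop)
    (u₀ : T → ℝ) (hu₀meas : Measurable u₀) (hu₀pos : ∀ t, 0 < u₀ t)
    (hno : ¬ ∃ α : ℝ, α ∈ Set.Ioo (0 : ℝ) 1 ∧
      ∃ c : T → EReal, Measurable c ∧ (∀ t, c t ≠ ⊤) ∧
        (∫⁻ t, phiE φ (c t) ∂μ < ⊤) ∧
        (∀ᵐ t ∂μ, ∀ u : ℝ, c t ≤ (u : EReal) → α * φ u ≤ φ (u - u₀ t))) :
    ∃ (c : ℕ → T → ℝ) (A : ℕ → Set T),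
      (∀ n, Measurable (c n)) ∧ (∀ n, MeasurableSet (A n)) ∧
      Pairwise (Function.onFun Disjoint A) ∧
      ∀ n, 1 ≤ n →
        (∫⁻ t in A n, ENNReal.ofReal (φ (c n t)) ∂μ = 1) ∧
        (∫⁻ t in A n, ENNReal.ofReal (φ (c n t - u₀ t)) ∂μ ≤ (2 : ENNReal)⁻¹ ^ n) := by
  classical
  have hφ : Continuous φ := by
    have := hconv.continuousOn isOpen_univ
    rwa [continuousOn_univ] at this
  have hφm := hφ.measurable
  have step : ∀ (n : ℕ) (E : {E : Set T // MeasurableSet E ∧ ¬ AuxSmallOn μ φ u₀ E}),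
      ∃ (c : T → ℝ) (A : Set T), Measurable c ∧ MeasurableSet A ∧ A ⊆ E.1 ∧
        ¬ AuxSmallOn μ φ u₀ (E.1 \ A) ∧
        (∫⁻ t in A, ENNReal.ofReal (φ (c t)) ∂μ = 1) ∧
        (∫⁻ t in A, ENNReal.ofReal (φ (c t - u₀ t)) ∂μ ≤ (2 : ENNReal)⁻¹ ^ n) := by
    rintro n ⟨E, hE, hbig⟩
    obtain ⟨c, A, hc, hA, hAE, hgood, hint⟩ := aux_big μ φ hφ htop u₀ hu₀meas E hE hbig
      ((2 : ℝ)⁻¹ ^ (n + 1)) ⟨by positivity, pow_lt_one₀ (by norm_num) (by norm_num) (by simp)⟩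
    have hgm : Measurable fun t => ENNReal.ofReal (φ (c t)) := by fun_prop
    let ν : Measure T := μ.withDensity fun t => ENNReal.ofReal (φ (c t))
    have hν : ∀ B, MeasurableSet B → ν B = ∫⁻ t in B, ENNReal.ofReal (φ (c t)) ∂μ :=
      fun B hB => withDensity_apply _ hB
    haveI : SigmaFinite ν := SigmaFinite.withDensity_ofReal (fun t => φ (c t))
    have hνna : ∀ A : Set T, MeasurableSet A → 0 < ν A →
        ∃ B ⊆ A, MeasurableSet B ∧ 0 < ν B ∧ 0 < ν (A \ B) := by
      intro A hA hpos
      let S : Set T := {t | 0 < ENNReal.ofReal (φ (c t))}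
      have hS : MeasurableSet S := measurableSet_lt measurable_const hgm
      have hposiff : ∀ B, MeasurableSet B → (0 < ν B ↔ 0 < μ (S ∩ B)) := by
        intro B hB
        rw [hν B hB, setLIntegral_pos_iff hgm]
        have : Function.support (fun t => ENNReal.ofReal (φ (c t))) = S := by
          ext t
          simp only [Function.mem_support, S, mem_ofPred_eq, pos_iff_ne_zero]
        rw [this]
      obtain ⟨B, hBA, hB, hB0, hBlt⟩ := hna (S ∩ A) (hS.inter hA) ((hposiff A hA).1 hpos)
      refine ⟨B, hBA.trans inter_subset_right, hB, ?_, ?_⟩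
      · rw [hposiff B hB, inter_eq_self_of_subset_right (hBA.trans inter_subset_left)]
        exact hB0
      · rw [hposiff _ (hA.diff hB), ← inter_sdiff_assoc]
        exact lt_of_lt_of_le (tsub_pos_of_lt hBlt) le_measure_sdiff
    rw [← hν A hA] at hint
    obtain ⟨A₁, hA₁, hA₁A, hA₁lt, hA₁fin⟩ := Measure.exists_subset_measure_lt_top hA hint
    obtain ⟨A₂, hA₂A, hA₂, hA₂ν⟩ := aux_sierp ν hνna A₁ hA₁ hA₁fin.ne 2 hA₁lt.le
    obtain ⟨B, hBA, hB, hBν⟩ := aux_sierp ν hνna A₂ hA₂ (by simp [hA₂ν]) 1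
      (by rw [hA₂ν]; exact one_le_two)
    have hCν : ν (A₂ \ B) = 1 := by
      rw [measure_sdiff hBA hB.nullMeasurableSet (by simp [hBν]), hA₂ν, hBν]
      have h2 : (2 : ENNReal) = 1 + 1 := one_add_one_eq_two.symm
      rw [h2]
      exact ENNReal.add_sub_cancel_right ENNReal.one_ne_top
    have hfinish : ∀ D ⊆ A₂, MeasurableSet D → ν D = 1 →
        (∫⁻ t in D, ENNReal.ofReal (φ (c t)) ∂μ = 1) ∧
        (∫⁻ t in D, ENNReal.ofReal (φ (c t - u₀ t)) ∂μ ≤ (2 : ENNReal)⁻¹ ^ n) := by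
      intro D hDA hD hD1
      rw [hν D hD] at hD1
      refine ⟨hD1, ?_⟩
      calc ∫⁻ t in D, ENNReal.ofReal (φ (c t - u₀ t)) ∂μ
          ≤ ∫⁻ t in D, (2 : ENNReal)⁻¹ ^ n * ENNReal.ofReal (φ (c t)) ∂μ := by
            apply setLIntegral_mono' hD
            intro t ht
            have h1 := hgood t (hA₁A (hA₂A (hDA ht)))
            have h2 : φ (c t - u₀ t) ≤ (2 : ℝ)⁻¹ ^ n * φ (c t) := by
              refine h1.le.trans (mul_le_mul_of_nonneg_right ?_ (hnonneg _))
              exact pow_le_pow_of_le_one (by norm_num) (by norm_num) (Nat.le_succ n)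
            refine (ENNReal.ofReal_le_ofReal h2).trans ?_
            rw [ENNReal.ofReal_mul (by positivity), ENNReal.ofReal_pow (by positivity),
              ENNReal.ofReal_inv_of_pos (by norm_num)]
            simp
        _ = (2 : ENNReal)⁻¹ ^ n := by
            rw [lintegral_const_mul _ hgm, hD1, mul_one]
    by_cases hcase : AuxSmallOn μ φ u₀ (E \ B)
    · refine ⟨c, A₂ \ B, hc, hA₂.diff hB,
        (sdiff_subset.trans hA₂A).trans (hA₁A.trans hAE), ?_,
        hfinish _ sdiff_subset (hA₂.diff hB) hCν⟩
      intro hcon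
      refine hbig (aux_union μ φ hnonneg u₀ (E \ B) (E \ (A₂ \ B)) E (hE.diff hB)
        (hE.diff (hA₂.diff hB)) ?_ hcase hcon)
      intro t ht
      by_cases htB : t ∈ B
      · exact Or.inr ⟨ht, fun h => h.2 htB⟩
      · exact Or.inl ⟨ht, htB⟩
    · exact ⟨c, B, hc, hB, (hBA.trans hA₂A).trans (hA₁A.trans hAE), hcase,
        hfinish _ hBA hB hBν⟩
  have h0 : ¬ AuxSmallOn μ φ u₀ univ := by
    intro h
    apply hno
    simpa [AuxSmallOn] using h
  choose c A hc hA hAE hbig hI1 hI2 using step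
  let Q : ℕ → {E : Set T // MeasurableSet E ∧ ¬ AuxSmallOn μ φ u₀ E} := fun k =>
    Nat.rec ⟨univ, MeasurableSet.univ, h0⟩
      (fun n E => ⟨E.1 \ A n E, E.2.1.diff (hA n E), hbig n E⟩) k
  have hQs : ∀ k, (Q (k+1)).1 = (Q k).1 \ A k (Q k) := fun k => rfl
  have hanti : Antitone fun k => (Q k).1 := by
    apply antitone_nat_of_succ_le
    intro k
    rw [hQs]
    exact sdiff_subset
  refine ⟨fun n => c n (Q n), fun n => A n (Q n), fun n => hc _ _, fun n => hA _ _, ?_,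
    fun n _ => ⟨hI1 _ _, hI2 _ _⟩⟩
  have hdis : ∀ m n, m < n → Disjoint (A m (Q m)) (A n (Q n)) := by
    intro m n hmn
    have h1 : A n (Q n) ⊆ (Q (m+1)).1 := (hAE n (Q n)).trans (hanti hmn)
    rw [hQs] at h1
    exact disjoint_sdiff_right.mono_right h1
  intro m n hmn
  rcases lt_or_gt_of_ne hmn with h | h
  · exact hdis m n h
  · exact (hdis n m h).symm
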